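/- Set G = 0 and call V ∈ 𝒫⁴ an evolution vector field if g_V′ = −ε₁·a·h_V and ρ_V = 0. For A = (A₁, A₂) ∈ 𝒫² let ∂_A be the unique ℝ-linear derivation of 𝒫 with ∂_A(kᵢ⁽ᵐ⁾) = Dᵐ(Aᵢ), and define Φ(V) = ∂_{(V̂(k₁), V̂(k₂))}. Then: (i) Φ(V) = V̂ for every evolution vector field V; (ii) the bracket of two evolution vector fields is again one, and Φ([V₁, V₂]) = Φ(V₁) ∘ Φ(V₂) − Φ(V₂) ∘ Φ(V₁); (iii) Φ is injective: if V̂(k₁) = 0 and V̂(k₂) = 0 for an evolution vector field V, then V = 0. In particular, two evolution vector fields V₁, V₂ satisfy [V₁, V₂] = 0 if and only if their curvature flows commute, i.e. ∂_{(V̂₁(k₁),V̂₁(k₂))} and ∂_{(V̂₂(k₁),V̂₂(k₂))} commute as derivations of 𝒫. -/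

import Mathlib

noncomputable section
open MvPolynomial

/-- The differential algebra `𝒫`: polynomials in `k₁⁽ᵐ⁾ = X (0, m)` and `k₂⁽ᵐ⁾ = X (1, m)`. -/
abbrev PP : Type := MvPolynomial (Fin 2 × ℕ) ℝ

/-- The derivation `f ↦ f′` with `D (kᵢ⁽ᵐ⁾) = kᵢ⁽ᵐ⁺¹⁾`. -/
def Dx : Derivation ℝ PP PP :=
  MvPolynomial.mkDerivation ℝ (fun im : Fin 2 × ℕ => MvPolynomial.X (im.1, im.2 + 1))

def k1 : PP := MvPolynomial.X (0, 0)
def k2 : PP := MvPolynomial.X (1, 0)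

/-- A `𝒫`-local vector field: a quadruple `(f, h, g, l) ∈ 𝒫⁴`. -/
structure LVF where
  f : PP
  h : PP
  g : PP
  l : PP

namespace LVF

instance : Zero LVF := ⟨⟨0, 0, 0, 0⟩⟩
instance : Neg LVF := ⟨fun U => ⟨-U.f, -U.h, -U.g, -U.l⟩⟩
instance : Add LVF := ⟨fun U W => ⟨U.f + W.f, U.h + W.h, U.g + W.g, U.l + W.l⟩⟩
instance : Sub LVF := ⟨fun U W => ⟨U.f - W.f, U.h - W.h, U.g - W.g, U.l - W.l⟩⟩

def phi (a ε₁ : ℝ) (V : LVF) : PP := C a * V.f + Dx V.h - C ε₁ * k1 * V.g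

def psi (ε₂ : ℝ) (V : LVF) : PP := Dx V.l + C ε₂ * k2 * V.g

def rho (a ε₁ : ℝ) (V : LVF) : PP :=
  - C a * Dx V.f + C (2 * a) * k1 * V.h - C a * k2 * V.l
    - Dx (phi a ε₁ V) + C ε₁ * k1 * Dx V.g

/-- Membership in `𝔛*`: `g_V′ = −ε₁·a·h_V`. -/
def isStar (a ε₁ : ℝ) (V : LVF) : Prop := Dx V.g = - C (ε₁ * a) * V.h

def alpha (a ε₁ : ℝ) (V : LVF) : PP :=
  C (1 / a) * (Dx (phi a ε₁ V) + C (1 / 2) * rho a ε₁ V)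

def beta (a ε₁ ε₂ G : ℝ) (V : LVF) : PP :=
  C (1 / a) * (Dx (alpha a ε₁ V) + k1 * phi a ε₁ V - k2 * psi ε₂ V - C G * V.g)

def delta (a ε₁ ε₂ : ℝ) (V : LVF) : PP :=
  C (1 / a) * Dx (Dx (psi ε₂ V)) + k1 * psi ε₂ V + C (ε₁ * ε₂) * k2 * phi a ε₁ V

/-- The value `V̂(k₁)`. -/
def vk1 (a ε₁ ε₂ G : ℝ) (V : LVF) : PP :=
  C (1 / a ^ 2) * Dx (Dx (Dx (phi a ε₁ V)))
    + C (1 / a) * (Dx (k1 * phi a ε₁ V) + k1 * Dx (phi a ε₁ V))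
    - C (1 / a) * (Dx (k2 * psi ε₂ V) + k2 * Dx (psi ε₂ V))
    + C (1 / a) * (C (1 / (2 * a)) * Dx (Dx (rho a ε₁ V)) + k1 * rho a ε₁ V
        - C (2 * G) * Dx V.g)

/-- The value `V̂(k₂)`. -/
def vk2 (a ε₁ ε₂ G : ℝ) (V : LVF) : PP :=
  C (ε₁ * ε₂ / a ^ 2) * Dx (Dx (Dx (psi ε₂ V)))
    + C (ε₁ * ε₂ / a) * (Dx (k1 * psi ε₂ V) + k1 * Dx (psi ε₂ V))
    + C (1 / a) * (Dx (k2 * phi a ε₁ V) + k2 * Dx (phi a ε₁ V))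
    + C (1 / a) * (k2 * rho a ε₁ V) - C (ε₂ * G) * V.l

/-- Values of `V̂` on the generators, defined by the recursion
`V̂(kᵢ⁽ᵐ⁺¹⁾) = (V̂(kᵢ⁽ᵐ⁾))′ + (1/(2a))·ρ_V·kᵢ⁽ᵐ⁺¹⁾`. -/
def vhatFun (a ε₁ ε₂ G : ℝ) (V : LVF) : Fin 2 × ℕ → PP := fun im =>
  Nat.rec (motive := fun _ => PP)
    (if im.1 = 0 then vk1 a ε₁ ε₂ G V else vk2 a ε₁ ε₂ G V)
    (fun m prev => Dx prev + C (1 / (2 * a)) * rho a ε₁ V * MvPolynomial.X (im.1, m + 1))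
    im.2

/-- The derivation `V̂` attached to `V ∈ 𝔛*`. -/
def vhat (a ε₁ ε₂ G : ℝ) (V : LVF) : Derivation ℝ PP PP :=
  MvPolynomial.mkDerivation ℝ (vhatFun a ε₁ ε₂ G V)

/-- The operator `D_V U`. -/
def DV (a ε₁ ε₂ G : ℝ) (V U : LVF) : LVF where
  f := vhat a ε₁ ε₂ G V U.f - alpha a ε₁ V * U.f - beta a ε₁ ε₂ G V * U.h
        + C (ε₁ * ε₂ / a) * delta a ε₁ ε₂ V * U.l
  h := vhat a ε₁ ε₂ G V U.h + phi a ε₁ V * U.f - C ε₁ * beta a ε₁ ε₂ G V * U.g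
        - C (ε₁ * ε₂ / a) * Dx (psi ε₂ V) * U.l
  g := vhat a ε₁ ε₂ G V U.g + C ε₁ * phi a ε₁ V * U.h + alpha a ε₁ V * U.g
        + C ε₂ * psi ε₂ V * U.l
  l := vhat a ε₁ ε₂ G V U.l + psi ε₂ V * U.f + C (1 / a) * Dx (psi ε₂ V) * U.h
        + C (ε₁ / a) * delta a ε₁ ε₂ V * U.g

/-- The bracket `[V₁, V₂] = D_{V₁}V₂ − D_{V₂}V₁`. -/
def bracket (a ε₁ ε₂ G : ℝ) (V₁ V₂ : LVF) : LVF :=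
  DV a ε₁ ε₂ G V₁ V₂ - DV a ε₁ ε₂ G V₂ V₁

end LVF

/-- An evolution vector field (case `G = 0`): `g_V′ = −ε₁ a h_V` and `ρ_V = 0`. -/
def LVF.isEvol (a ε₁ : ℝ) (V : LVF) : Prop := LVF.isStar a ε₁ V ∧ LVF.rho a ε₁ V = 0

/-- The evolution derivation `∂_A` with characteristic `A = (A₁, A₂) ∈ 𝒫²`. -/
def evolDer2 (A : PP × PP) : Derivation ℝ PP PP :=
  MvPolynomial.mkDerivation ℝ (fun im : Fin 2 × ℕ =>
    (fun p => Dx p)^[im.2] (if im.1 = 0 then A.1 else A.2))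

/-- The map `Φ(V) = ∂_{(V̂(k₁), V̂(k₂))}` (case `G = 0`). -/
def Phi (a ε₁ ε₂ : ℝ) (V : LVF) : Derivation ℝ PP PP :=
  evolDer2 (LVF.vhat a ε₁ ε₂ 0 V k1, LVF.vhat a ε₁ ε₂ 0 V k2)


namespace LVF

theorem sub_f (U W : LVF) : (U - W).f = U.f - W.f := rfl
theorem sub_h (U W : LVF) : (U - W).h = U.h - W.h := rfl
theorem sub_g (U W : LVF) : (U - W).g = U.g - W.g := rfl
theorem sub_l (U W : LVF) : (U - W).l = U.l - W.l := rfl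

end LVF

theorem Dx_X (im : Fin 2 × ℕ) : Dx (X im) = X (im.1, im.2 + 1) := mkDerivation_X ℝ _ im

/-- A derivation commutes with `Dx` as soon as it does so on the generators. -/
theorem Dx_comm_of_X {d : Derivation ℝ PP PP} (h : ∀ im, Dx (d (X im)) = d (Dx (X im))) (p : PP) :
    Dx (d p) = d (Dx p) := by
  have h0 : ⁅Dx, d⁆ = 0 := MvPolynomial.derivation_ext fun im => by
    simp [Derivation.commutator_apply, h]
  have := congrArg (fun e : Derivation ℝ PP PP => e p) h0
  simpa [Derivation.commutator_apply, sub_eq_zero] using this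

/-- A derivation commuting with `Dx` is determined by its values on `k1` and `k2`. -/
theorem derivation_ext_of_Dx_comm {d e : Derivation ℝ PP PP} (hd : ∀ p, Dx (d p) = d (Dx p))
    (he : ∀ p, Dx (e p) = e (Dx p)) (h₁ : d k1 = e k1) (h₂ : d k2 = e k2) : d = e := by
  refine MvPolynomial.derivation_ext fun ⟨i, m⟩ => ?_
  induction m with
  | zero => fin_cases i; exacts [h₁, h₂]
  | succ m ih =>
    have h := congrArg Dx ih
    rwa [hd, he, Dx_X] at h

theorem evolDer2_X (A : PP × PP) (im : Fin 2 × ℕ) :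
    evolDer2 A (X im) = (fun p => Dx p)^[im.2] (if im.1 = 0 then A.1 else A.2) :=
  mkDerivation_X ℝ _ im

theorem evolDer2_k1 (A : PP × PP) : evolDer2 A k1 = A.1 := evolDer2_X A (0, 0)

theorem evolDer2_k2 (A : PP × PP) : evolDer2 A k2 = A.2 := evolDer2_X A (1, 0)

theorem Dx_evolDer2 (A : PP × PP) (p : PP) : Dx (evolDer2 A p) = evolDer2 A (Dx p) :=
  Dx_comm_of_X (fun im => by
    rw [Dx_X, evolDer2_X, evolDer2_X, Function.iterate_succ_apply']) p

namespace LVF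

theorem vhat_X (a ε₁ ε₂ G : ℝ) (V : LVF) (im : Fin 2 × ℕ) :
    vhat a ε₁ ε₂ G V (X im) = vhatFun a ε₁ ε₂ G V im := mkDerivation_X ℝ _ im

theorem vhat_k1 (a ε₁ ε₂ G : ℝ) (V : LVF) : vhat a ε₁ ε₂ G V k1 = vk1 a ε₁ ε₂ G V :=
  vhat_X a ε₁ ε₂ G V (0, 0)

theorem vhat_k2 (a ε₁ ε₂ G : ℝ) (V : LVF) : vhat a ε₁ ε₂ G V k2 = vk2 a ε₁ ε₂ G V :=
  vhat_X a ε₁ ε₂ G V (1, 0)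

theorem Dx_vhat {a ε₁ : ℝ} (ε₂ G : ℝ) {V : LVF} (hV : rho a ε₁ V = 0) (p : PP) :
    Dx (vhat a ε₁ ε₂ G V p) = vhat a ε₁ ε₂ G V (Dx p) :=
  Dx_comm_of_X (fun im => by
    rw [Dx_X, vhat_X, vhat_X]
    simp [vhatFun, hV]) p

end LVF

/-- An infinitesimal rotation of the null frame: the coordinates of an element of the
six-dimensional Lie algebra in which the Cartan matrix takes its values. -/
structure Rot where
  α : PP
  β : PP
  γ : PP
  φ : PP
  ψ : PP
  η : PP

namespace Rot

/-- The curvature `d₁ M₂ − d₂ M₁ + [M₁, M₂]`, in coordinates. -/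
def curv (e₁ e₂ : PP) (d₁ d₂ : Derivation ℝ PP PP) (M N : Rot) : Rot where
  α := d₁ N.α - d₂ M.α + (M.β * N.φ - N.β * M.φ) - e₁ * e₂ * (M.γ * N.ψ - N.γ * M.ψ)
  β := d₁ N.β - d₂ M.β - (M.α * N.β - N.α * M.β) - e₁ * e₂ * (M.γ * N.η - N.γ * M.η)
  γ := d₁ N.γ - d₂ M.γ - (M.η * N.β - N.η * M.β) + (M.γ * N.α - N.γ * M.α)
  φ := d₁ N.φ - d₂ M.φ - (M.φ * N.α - N.φ * M.α) - e₁ * e₂ * (M.η * N.ψ - N.η * M.ψ)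
  ψ := d₁ N.ψ - d₂ M.ψ - (M.ψ * N.α - N.ψ * M.α) + (M.η * N.φ - N.η * M.φ)
  η := d₁ N.η - d₂ M.η - (M.ψ * N.β - N.ψ * M.β) + (M.γ * N.φ - N.γ * M.φ)

/-- The zero curvature equation `M′ = L̇ + [M, L]` for the Cartan matrix `L`, where `p` and `q`
are the variations of the two curvatures. -/
structure IsFlat (a : ℝ) (e₁ e₂ : PP) (p q : PP) (M : Rot) : Prop where
  φ : Dx M.φ = C a * M.α
  ψ : Dx M.ψ = C a * M.η
  α : Dx M.α = C a * M.β - k1 * M.φ + k2 * M.ψ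
  η : Dx M.η = C a * M.γ - k1 * M.ψ - e₁ * e₂ * k2 * M.φ
  β : Dx M.β = p - k1 * M.α + k2 * M.η
  γ : Dx M.γ = e₁ * e₂ * q - k1 * M.η - e₁ * e₂ * k2 * M.α

/-- The structure equations `∇V = M e_f` relating a vector field and its rotation. -/
structure IsFrame (a : ℝ) (e₁ e₂ : PP) (V : LVF) (M : Rot) : Prop where
  f : Dx V.f = - M.α + k1 * V.h - k2 * V.l
  h : Dx V.h = M.φ - C a * V.f + e₁ * k1 * V.g
  g : Dx V.g = - e₁ * C a * V.h
  l : Dx V.l = M.ψ - e₂ * k2 * V.g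

/-- The action of `d + M` on a vector field. -/
def act (e₁ e₂ : PP) (d : Derivation ℝ PP PP) (M : Rot) (U : LVF) : LVF where
  f := d U.f - M.α * U.f - M.β * U.h + e₁ * e₂ * M.γ * U.l
  h := d U.h + M.φ * U.f - e₁ * M.β * U.g - e₁ * e₂ * M.η * U.l
  g := d U.g + e₁ * M.φ * U.h + M.α * U.g + e₂ * M.ψ * U.l
  l := d U.l + M.ψ * U.f + M.η * U.h + e₁ * M.γ * U.g

theorem IsFlat.curv {a : ℝ} {e₁ e₂ : PP} (he₁ : e₁ = 1 ∨ e₁ = -1) (he₂ : e₂ = 1 ∨ e₂ = -1)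
    {d₁ d₂ : Derivation ℝ PP PP} (h₁ : ∀ p, Dx (d₁ p) = d₁ (Dx p))
    (h₂ : ∀ p, Dx (d₂ p) = d₂ (Dx p)) {M N : Rot}
    (hM : IsFlat a e₁ e₂ (d₁ k1) (d₁ k2) M) (hN : IsFlat a e₁ e₂ (d₂ k1) (d₂ k2) N) :
    IsFlat a e₁ e₂ (d₁ (d₂ k1) - d₂ (d₁ k1)) (d₁ (d₂ k2) - d₂ (d₁ k2))
      (Rot.curv e₁ e₂ d₁ d₂ M N) := by
  rcases he₁ with rfl | rfl <;> rcases he₂ with rfl | rfl <;> constructor <;>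
  · simp only [Rot.curv, map_add, map_sub, map_neg, Derivation.leibniz, smul_eq_mul, h₁, h₂,
      hM.φ, hM.ψ, hM.α, hM.η, hM.β, hM.γ, hN.φ, hN.ψ, hN.α, hN.η, hN.β, hN.γ, derivation_C,
      Derivation.map_one_eq_zero]
    ring

theorem IsFrame.bracket {a : ℝ} {e₁ e₂ : PP} (he₁ : e₁ = 1 ∨ e₁ = -1) (he₂ : e₂ = 1 ∨ e₂ = -1)
    {d₁ d₂ : Derivation ℝ PP PP} (h₁ : ∀ p, Dx (d₁ p) = d₁ (Dx p))
    (h₂ : ∀ p, Dx (d₂ p) = d₂ (Dx p)) {M N : Rot} {V W : LVF}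
    (hM : IsFlat a e₁ e₂ (d₁ k1) (d₁ k2) M) (hN : IsFlat a e₁ e₂ (d₂ k1) (d₂ k2) N)
    (hV : IsFrame a e₁ e₂ V M) (hW : IsFrame a e₁ e₂ W N) :
    IsFrame a e₁ e₂ (act e₁ e₂ d₁ M W - act e₁ e₂ d₂ N V) (Rot.curv e₁ e₂ d₁ d₂ M N) := by
  rcases he₁ with rfl | rfl <;> rcases he₂ with rfl | rfl <;> constructor <;>
  · simp only [LVF.sub_f, LVF.sub_h, LVF.sub_g, LVF.sub_l, act]
    simp only [Rot.curv, map_add, map_sub, map_neg, Derivation.leibniz, smul_eq_mul, h₁, h₂,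
      hM.φ, hM.ψ, hM.α, hM.η, hM.β, hM.γ, hN.φ, hN.ψ, hN.α, hN.η, hN.β, hN.γ, derivation_C,
      hV.f, hV.h, hV.g, hV.l, hW.f, hW.h, hW.g, hW.l, Derivation.map_one_eq_zero]
    ring

end Rot

/-- The differential polynomials of order less than `N`. -/
def orderLT (N : ℕ) : Subalgebra ℝ PP where
  carrier := {p | ∀ i m, N ≤ m → pderiv (i, m) p = 0}
  mul_mem' hp hq i m hm := by simp [Derivation.leibniz, hp i m hm, hq i m hm]
  add_mem' hp hq i m hm := by simp [hp i m hm, hq i m hm]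
  algebraMap_mem' r _ _ _ := Derivation.map_algebraMap _ r

theorem X_mem_orderLT {i : Fin 2} {m N : ℕ} (h : m < N) : (X (i, m) : PP) ∈ orderLT N :=
  fun j n hn => pderiv_X_of_ne (by simp; lia)

theorem exists_mem_orderLT (p : PP) : ∃ N, p ∈ orderLT N := by
  refine ⟨p.vars.sup Prod.snd + 1, fun i m hm => pderiv_eq_zero_of_notMem_vars fun h => ?_⟩
  have : m ≤ p.vars.sup Prod.snd := Finset.le_sup (f := Prod.snd) h
  lia

theorem orderLT_mono {M N : ℕ} (h : M ≤ N) : orderLT M ≤ orderLT N :=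
  fun _ hp i m hm => hp i m (h.trans hm)

theorem pderiv_succ_Dx (i : Fin 2) (m : ℕ) (p : PP) :
    pderiv (i, m + 1) (Dx p) = Dx (pderiv (i, m + 1) p) + pderiv (i, m) p := by
  have h : ⁅pderiv (i, m + 1), Dx⁆ = (pderiv (i, m) : Derivation ℝ PP PP) :=
    MvPolynomial.derivation_ext fun ⟨j, n⟩ => by
      rw [Derivation.commutator_apply, Dx_X, pderiv_X, pderiv_X, pderiv_X]
      by_cases hj : j = i <;> by_cases hn : n = m <;> by_cases hn' : n = m + 1 <;>
        simp [hj, hn, hn']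
  rw [← h, Derivation.commutator_apply]
  ring

/-- Differentiation raises the order of every nonconstant differential polynomial. -/
theorem mem_orderLT_of_Dx_mem {N : ℕ} {p : PP} (h : Dx p ∈ orderLT (N + 1)) : p ∈ orderLT N := by
  obtain ⟨K, hK⟩ := exists_mem_orderLT p
  have key : ∀ j m i, N ≤ m → K ≤ m + j → pderiv (i, m) p = 0 := by
    intro j
    induction j with
    | zero => exact fun m i _ hm => hK i m hm
    | succ j ih =>
      intro m i hN hm
      have h₁ := pderiv_succ_Dx i m p
      rw [h i (m + 1) (by lia), ih (m + 1) i (by lia) (by lia), map_zero, zero_add] at h₁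
      exact h₁.symm
  exact fun i m hm => key K m i hm (by lia)

theorem eq_C_of_mem_orderLT_zero {p : PP} (h : p ∈ orderLT 0) : ∃ c : ℝ, p = C c := by
  refine ⟨coeff 0 p, MvPolynomial.ext _ _ fun s => ?_⟩
  rw [coeff_C]
  split_ifs with hs
  · rw [hs]
  · obtain ⟨⟨i, m⟩, him⟩ := Finsupp.ne_iff.mp (Ne.symm hs)
    have h₁ := congrArg (coeff (s - Finsupp.single (i, m) 1)) (h i m (Nat.zero_le m))
    rw [coeff_pderiv, coeff_zero, tsub_add_cancel_of_le
      (Finsupp.single_le_iff.mpr (Nat.one_le_iff_ne_zero.mpr him))] at h₁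
    exact (mul_eq_zero.mp h₁).resolve_right (by positivity)

/-- A first-order differential system whose coefficients depend on `k1` and `k2` only has no
nonconstant solution in differential polynomials. -/
theorem eq_C_of_Dx_mem {s : Set PP} (hs : s.Finite)
    (h : ∀ B : Subalgebra ℝ PP, k1 ∈ B → k2 ∈ B → s ⊆ B → ∀ p ∈ s, Dx p ∈ B) :
    ∀ p ∈ s, ∃ c : ℝ, p = C c := by
  choose ord hord using exists_mem_orderLT
  have hK : s ⊆ orderLT (hs.toFinset.sup ord) := fun p hp =>
    orderLT_mono (Finset.le_sup (hs.mem_toFinset.mpr hp)) (hord p)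
  have key : ∀ N, s ⊆ orderLT N → s ⊆ orderLT 0 := by
    intro N
    induction N with
    | zero => exact id
    | succ N ih =>
      exact fun hN => ih fun p hp => mem_orderLT_of_Dx_mem
        (h _ (X_mem_orderLT N.succ_pos) (X_mem_orderLT N.succ_pos) hN p hp)
  exact fun p hp => eq_C_of_mem_orderLT_zero (key _ hK hp)

theorem C_eq_zero_of_k_mul {x y z : ℝ} (h : (0 : PP) = C x + k1 * C y + k2 * C z) :
    x = 0 ∧ y = 0 ∧ z = 0 := by
  have h₀ := congrArg (eval fun _ => (0 : ℝ)) h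
  have h₁ := congrArg (eval fun im => if im.1 = 0 then (1 : ℝ) else 0) h
  have h₂ := congrArg (eval fun im => if im.1 = 0 then (0 : ℝ) else 1) h
  simp [k1, k2] at h₀ h₁ h₂
  refine ⟨?_, ?_, ?_⟩ <;> linarith

theorem C_ne_zero {c : ℝ} (h : c ≠ 0) : (C c : PP) ≠ 0 := by
  rwa [Ne, C_eq_zero]

namespace Rot

theorem IsFlat.unique {a : ℝ} (ha : a ≠ 0) {e₁ e₂ : PP} (he₁ : e₁ ≠ 0) (he₂ : e₂ ≠ 0)
    {p q p' q' : PP} {M N : Rot} (hM : IsFlat a e₁ e₂ p q M) (hN : IsFlat a e₁ e₂ p' q' N)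
    (hφ : M.φ = N.φ) (hψ : M.ψ = N.ψ) : p = p' ∧ q = q' := by
  have hC := C_ne_zero ha
  have hα : M.α = N.α := mul_left_cancel₀ hC <| by rw [← hM.φ, ← hN.φ, hφ]
  have hη : M.η = N.η := mul_left_cancel₀ hC <| by rw [← hM.ψ, ← hN.ψ, hψ]
  have hβ : M.β = N.β := mul_left_cancel₀ hC <| by
    have h₁ := hM.α
    rw [hα, hN.α, hφ, hψ] at h₁
    linear_combination -h₁
  have hγ : M.γ = N.γ := mul_left_cancel₀ hC <| by
    have h₁ := hM.η
    rw [hη, hN.η, hφ, hψ] at h₁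
    linear_combination -h₁
  constructor
  · have h₁ := hM.β
    rw [hβ, hN.β, hα, hη] at h₁
    linear_combination -h₁
  · have h₁ := hM.γ
    rw [hγ, hN.γ, hα, hη] at h₁
    exact mul_left_cancel₀ (mul_ne_zero he₁ he₂) (by linear_combination -h₁)

theorem IsFlat.eq_zero {a e₁ e₂ : ℝ} (ha : a ≠ 0) {M : Rot}
    (h : IsFlat a (C e₁) (C e₂) 0 0 M) : M.α = 0 ∧ M.φ = 0 ∧ M.ψ = 0 := by
  have hC := eq_C_of_Dx_mem (s := {M.α, M.β, M.γ, M.φ, M.ψ, M.η}) (by simp) fun B h₁ h₂ hB => by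
    have hc : ∀ c : ℝ, (C c : PP) ∈ B := B.algebraMap_mem
    simp only [Set.insert_subset_iff, Set.singleton_subset_iff, SetLike.mem_coe] at hB
    obtain ⟨hα, hβ, hγ, hφ, hψ, hη⟩ := hB
    rintro p (rfl | rfl | rfl | rfl | rfl | rfl) <;>
    simp only [h.α, h.β, h.γ, h.φ, h.ψ, h.η] <;>
    apply_rules [B.add_mem, B.sub_mem, B.mul_mem, B.zero_mem]
  simp only [Set.mem_insert_iff, Set.mem_singleton_iff, forall_eq_or_imp, forall_eq] at hC
  obtain ⟨⟨α, hα⟩, ⟨β, hβ⟩, -, ⟨φ, hφ⟩, ⟨ψ, hψ⟩, -⟩ := hC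
  have h₁ := h.φ
  have h₂ := h.α
  rw [hφ, derivation_C, hα] at h₁
  rw [hα, derivation_C, hβ, hφ, hψ] at h₂
  have h₃ : α = 0 := by
    simpa [ha] using h₁.symm
  obtain ⟨-, h₄, h₅⟩ := C_eq_zero_of_k_mul (x := a * β) (y := -φ) (z := ψ) (by
    rw [h₂, C_mul, C_neg]; ring)
  rw [hα, hφ, hψ, h₃, neg_eq_zero.mp h₄, h₅]
  simp

theorem IsFrame.eq_zero {a e₁ e₂ : ℝ} (ha : a ≠ 0) (he₁ : e₁ ≠ 0) {V : LVF} {M : Rot}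
    (h : IsFrame a (C e₁) (C e₂) V M) (hα : M.α = 0) (hφ : M.φ = 0) (hψ : M.ψ = 0) : V = 0 := by
  have hf := h.f
  have hh := h.h
  have hg := h.g
  have hl := h.l
  rw [hα] at hf
  rw [hφ] at hh
  rw [hψ] at hl
  have hC := eq_C_of_Dx_mem (s := {V.f, V.h, V.g, V.l}) (by simp) fun B h₁ h₂ hB => by
    have hc : ∀ c : ℝ, (C c : PP) ∈ B := B.algebraMap_mem
    simp only [Set.insert_subset_iff, Set.singleton_subset_iff, SetLike.mem_coe] at hB
    obtain ⟨hf', hh', hg', hl'⟩ := hB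
    rintro p (rfl | rfl | rfl | rfl) <;>
    simp only [hf, hh, hg, hl] <;>
    apply_rules [B.add_mem, B.sub_mem, B.mul_mem, B.zero_mem, B.neg_mem]
  simp only [Set.mem_insert_iff, Set.mem_singleton_iff, forall_eq_or_imp, forall_eq] at hC
  obtain ⟨⟨f, Hf⟩, ⟨h', Hh⟩, ⟨g, Hg⟩, ⟨l, Hl⟩⟩ := hC
  rw [Hf, derivation_C, Hh, Hl] at hf
  rw [Hh, derivation_C, Hf, Hg] at hh
  obtain ⟨-, h₁, h₂⟩ := C_eq_zero_of_k_mul (x := 0) (y := h') (z := -l) (by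
    rw [hf, C_neg, C_0]; ring)
  obtain ⟨h₃, h₄, -⟩ := C_eq_zero_of_k_mul (x := -(a * f)) (y := e₁ * g) (z := 0) (by
    rw [hh, C_neg, C_0, C_mul, C_mul]; ring)
  have h₅ : f = 0 := by simpa [ha] using h₃
  have h₆ : g = 0 := by simpa [he₁] using h₄
  obtain ⟨Vf, Vh, Vg, Vl⟩ := V
  simp only at Hf Hh Hg Hl
  rw [Hf, Hh, Hg, Hl, h₁, neg_eq_zero.mp h₂, h₅, h₆, C_0]
  rfl

end Rot

namespace LVF

/-- The rotation of the frame induced by a vector field in flat space. -/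
def rot (a ε₁ ε₂ : ℝ) (V : LVF) : Rot where
  α := alpha a ε₁ V
  β := beta a ε₁ ε₂ 0 V
  γ := C (1 / a) * delta a ε₁ ε₂ V
  φ := phi a ε₁ V
  ψ := psi ε₂ V
  η := C (1 / a) * Dx (psi ε₂ V)

theorem DV_eq_act (a ε₁ ε₂ : ℝ) (V U : LVF) :
    DV a ε₁ ε₂ 0 V U = Rot.act (C ε₁) (C ε₂) (vhat a ε₁ ε₂ 0 V) (rot a ε₁ ε₂ V) U := by
  simp only [DV, Rot.act, rot, div_eq_mul_one_div (_ * _) a, div_eq_mul_one_div ε₁ a, C_mul,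
    mul_assoc]

theorem C_mul_C_one_div {a : ℝ} (ha : a ≠ 0) : (C a * C (1 / a) : PP) = 1 := by
  rw [← C_mul, mul_one_div_cancel ha, C_1]

theorem isFlat_rot {a ε₁ ε₂ : ℝ} (ha : a ≠ 0) (hε₁ : ε₁ = 1 ∨ ε₁ = -1)
    (hε₂ : ε₂ = 1 ∨ ε₂ = -1) {V : LVF} (hV : rho a ε₁ V = 0) :
    Rot.IsFlat a (C ε₁) (C ε₂) (vhat a ε₁ ε₂ 0 V k1) (vhat a ε₁ ε₂ 0 V k2) (rot a ε₁ ε₂ V) := by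
  have hA := C_mul_C_one_div ha
  rw [vhat_k1, vhat_k2]
  constructor
  · simp only [rot, alpha, hV]
    linear_combination (-Dx (phi a ε₁ V)) * hA
  · simp only [rot]
    linear_combination (-Dx (psi ε₂ V)) * hA
  · simp only [rot, beta, C_0]
    linear_combination (-Dx (alpha a ε₁ V) - k1 * phi a ε₁ V + k2 * psi ε₂ V) * hA
  · simp only [rot, delta, Derivation.leibniz, derivation_C, C_mul, smul_eq_mul]
    linear_combination (-C (1 / a) * Dx (Dx (psi ε₂ V)) - k1 * psi ε₂ V
      - C ε₁ * C ε₂ * k2 * phi a ε₁ V) * hA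
  · simp only [rot, vk1, beta, alpha, hV, Derivation.leibniz, derivation_C, smul_eq_mul, map_add,
      map_sub, map_zero, mul_zero, zero_mul, add_zero, sub_zero]
    simp only [← one_div_pow, C_pow]
    ring
  · have he : (C (ε₁ * ε₂ * (ε₁ * ε₂)) : PP) = 1 := by
      rw [← C_1]
      congr 1
      rcases hε₁ with rfl | rfl <;> rcases hε₂ with rfl | rfl <;> norm_num
    simp only [rot, vk2, delta, alpha, hV, div_eq_mul_one_div (_ * _) (_ : ℝ),
      Derivation.leibniz, derivation_C, smul_eq_mul,
      map_add, map_zero, mul_zero, zero_mul, add_zero, sub_zero]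
    simp only [← one_div_pow, C_pow, C_mul] at he ⊢
    generalize (C ε₁ : PP) = x at *
    generalize (C ε₂ : PP) = y at *
    generalize (C (1 / a) : PP) = z at *
    linear_combination (-(z ^ 2 * Dx (Dx (Dx (psi ε₂ V)))) - 2 * z * k1 * Dx (psi ε₂ V)
      - z * psi ε₂ V * Dx k1) * he

theorem isFrame_rot {a ε₁ ε₂ : ℝ} (ha : a ≠ 0) (hε₁ : ε₁ = 1 ∨ ε₁ = -1)
    {V : LVF} (hV : isEvol a ε₁ V) :
    Rot.IsFrame a (C ε₁) (C ε₂) V (rot a ε₁ ε₂ V) := by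
  have hA := C_mul_C_one_div ha
  obtain ⟨h₁, h₂⟩ := hV
  have hg : Dx V.g = - C ε₁ * C a * V.h := by rw [h₁, C_mul]; ring
  constructor
  · have h₃ := h₂
    rw [rho, hg, C_mul, map_ofNat C 2] at h₃
    have he : (C ε₁ * C ε₁ : PP) = 1 := by rcases hε₁ with rfl | rfl <;> simp
    simp only [rot, alpha, h₂]
    linear_combination (-C (1 / a)) * h₃ + (k1 * V.h - Dx V.f - k2 * V.l) * hA
      - k1 * V.h * C a * C (1 / a) * he
  · simp only [rot, phi]
    ring
  · exact hg
  · simp only [rot, psi]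
    ring

theorem isEvol_of_isFrame {a ε₁ ε₂ : ℝ} (hε₁ : ε₁ = 1 ∨ ε₁ = -1) {V : LVF} {M : Rot} {p q : PP}
    (hV : Rot.IsFrame a (C ε₁) (C ε₂) V M) (hM : Rot.IsFlat a (C ε₁) (C ε₂) p q M) :
    isEvol a ε₁ V ∧ phi a ε₁ V = M.φ ∧ psi ε₂ V = M.ψ := by
  have hφ : phi a ε₁ V = M.φ := by rw [phi, hV.h]; ring
  have he : (C ε₁ * C ε₁ : PP) = 1 := by rcases hε₁ with rfl | rfl <;> simp
  refine ⟨⟨?_, ?_⟩, hφ, ?_⟩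
  · rw [isStar, hV.g, C_mul]
    ring
  · rw [rho, hφ, hM.φ, hV.f, hV.g, C_mul, map_ofNat C 2]
    linear_combination (-k1 * C a * V.h) * he
  · rw [psi, hV.l]
    ring

variable {a ε₁ ε₂ : ℝ}

theorem isEvol_bracket (ha : a ≠ 0) (hε₁ : ε₁ = 1 ∨ ε₁ = -1) (hε₂ : ε₂ = 1 ∨ ε₂ = -1)
    {V W : LVF} (hV : isEvol a ε₁ V) (hW : isEvol a ε₁ W) :
    isEvol a ε₁ (bracket a ε₁ ε₂ 0 V W) ∧
    ∀ k ∈ ({k1, k2} : Set PP), vhat a ε₁ ε₂ 0 (bracket a ε₁ ε₂ 0 V W) k =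
      ⁅vhat a ε₁ ε₂ 0 V, vhat a ε₁ ε₂ 0 W⁆ k := by
  have he₁ : (C ε₁ : PP) = 1 ∨ (C ε₁ : PP) = -1 :=
    hε₁.imp (by simp +contextual) (by simp +contextual)
  have he₂ : (C ε₂ : PP) = 1 ∨ (C ε₂ : PP) = -1 :=
    hε₂.imp (by simp +contextual) (by simp +contextual)
  have h0₁ : ε₁ ≠ 0 := by rcases hε₁ with rfl | rfl <;> norm_num
  have h0₂ : ε₂ ≠ 0 := by rcases hε₂ with rfl | rfl <;> norm_num
  have hMV := isFlat_rot ha hε₁ hε₂ hV.2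
  have hMW := isFlat_rot ha hε₁ hε₂ hW.2
  have hflat := Rot.IsFlat.curv he₁ he₂ (Dx_vhat ε₂ 0 hV.2) (Dx_vhat ε₂ 0 hW.2) hMV hMW
  have hframe := Rot.IsFrame.bracket he₁ he₂ (Dx_vhat ε₂ 0 hV.2) (Dx_vhat ε₂ 0 hW.2) hMV hMW
    (isFrame_rot ha hε₁ hV) (isFrame_rot ha hε₁ hW)
  rw [← DV_eq_act, ← DV_eq_act, ← bracket] at hframe
  obtain ⟨hevol, hφ, hψ⟩ := isEvol_of_isFrame hε₁ hframe hflat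
  obtain ⟨h₁, h₂⟩ := (isFlat_rot ha hε₁ hε₂ hevol.2).unique ha (C_ne_zero h0₁) (C_ne_zero h0₂)
    hflat hφ hψ
  refine ⟨hevol, ?_⟩
  rintro k (rfl | rfl)
  exacts [h₁, h₂]

theorem Phi_eq_vhat {V : LVF} (hV : isEvol a ε₁ V) : Phi a ε₁ ε₂ V = vhat a ε₁ ε₂ 0 V :=
  derivation_ext_of_Dx_comm (Dx_evolDer2 _) (Dx_vhat ε₂ 0 hV.2) (evolDer2_k1 _) (evolDer2_k2 _)

theorem Phi_bracket (ha : a ≠ 0) (hε₁ : ε₁ = 1 ∨ ε₁ = -1) (hε₂ : ε₂ = 1 ∨ ε₂ = -1)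
    {V W : LVF} (hV : isEvol a ε₁ V) (hW : isEvol a ε₁ W) :
    Phi a ε₁ ε₂ (bracket a ε₁ ε₂ 0 V W) = ⁅Phi a ε₁ ε₂ V, Phi a ε₁ ε₂ W⁆ := by
  obtain ⟨hevol, hk⟩ := isEvol_bracket ha hε₁ hε₂ hV hW
  rw [Phi_eq_vhat hV, Phi_eq_vhat hW, Phi_eq_vhat hevol]
  refine derivation_ext_of_Dx_comm (Dx_vhat ε₂ 0 hevol.2) (fun p => ?_) (hk k1 (by simp))
    (hk k2 (by simp))
  simp only [Derivation.commutator_apply, map_sub, Dx_vhat ε₂ 0 hV.2, Dx_vhat ε₂ 0 hW.2]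

theorem eq_zero_of_vhat_eq_zero (ha : a ≠ 0) (hε₁ : ε₁ = 1 ∨ ε₁ = -1)
    (hε₂ : ε₂ = 1 ∨ ε₂ = -1) {V : LVF} (hV : isEvol a ε₁ V)
    (h₁ : vhat a ε₁ ε₂ 0 V k1 = 0) (h₂ : vhat a ε₁ ε₂ 0 V k2 = 0) : V = 0 := by
  have h0 : ε₁ ≠ 0 := by rcases hε₁ with rfl | rfl <;> norm_num
  have hM := isFlat_rot ha hε₁ hε₂ hV.2
  rw [h₁, h₂] at hM
  obtain ⟨hα, hφ, hψ⟩ := hM.eq_zero ha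
  exact (isFrame_rot ha hε₁ hV).eq_zero ha h0 hα hφ hψ

theorem zero_f : (0 : LVF).f = 0 := rfl
theorem zero_h : (0 : LVF).h = 0 := rfl
theorem zero_g : (0 : LVF).g = 0 := rfl
theorem zero_l : (0 : LVF).l = 0 := rfl

theorem isEvol_zero : isEvol a ε₁ 0 := by
  simp [isEvol, isStar, rho, phi, zero_f, zero_h, zero_g, zero_l]

theorem vhat_zero_k : vhat a ε₁ ε₂ 0 0 k1 = 0 ∧ vhat a ε₁ ε₂ 0 0 k2 = 0 := by
  have hφ : phi a ε₁ 0 = 0 := by simp [phi, zero_f, zero_h, zero_g]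
  have hψ : psi ε₂ 0 = 0 := by simp [psi, zero_g, zero_l]
  have hρ : rho a ε₁ 0 = 0 := isEvol_zero.2
  simp [vhat_k1, vhat_k2, vk1, vk2, hφ, hψ, hρ]

end LVF


open LVF in
/-- `Φ` is an injective morphism of Lie algebras from the evolution
vector fields to the evolution derivations; two evolution vector fields commute iff their
curvature flows commute. -/
theorem stmt15 (a ε₁ ε₂ : ℝ) (ha : a ≠ 0) (hε₁ : ε₁ = 1 ∨ ε₁ = -1)
    (hε₂ : ε₂ = 1 ∨ ε₂ = -1) :
    (∀ V : LVF, isEvol a ε₁ V → Phi a ε₁ ε₂ V = vhat a ε₁ ε₂ 0 V) ∧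
    (∀ V₁ V₂ : LVF, isEvol a ε₁ V₁ → isEvol a ε₁ V₂ →
      isEvol a ε₁ (bracket a ε₁ ε₂ 0 V₁ V₂) ∧
      ∀ f : PP, Phi a ε₁ ε₂ (bracket a ε₁ ε₂ 0 V₁ V₂) f =
        Phi a ε₁ ε₂ V₁ (Phi a ε₁ ε₂ V₂ f) - Phi a ε₁ ε₂ V₂ (Phi a ε₁ ε₂ V₁ f)) ∧
    (∀ V : LVF, isEvol a ε₁ V → LVF.vhat a ε₁ ε₂ 0 V k1 = 0 →
      LVF.vhat a ε₁ ε₂ 0 V k2 = 0 → V = 0) ∧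
    (∀ V₁ V₂ : LVF, isEvol a ε₁ V₁ → isEvol a ε₁ V₂ →
      (bracket a ε₁ ε₂ 0 V₁ V₂ = 0 ↔
        ∀ f : PP, Phi a ε₁ ε₂ V₁ (Phi a ε₁ ε₂ V₂ f) = Phi a ε₁ ε₂ V₂ (Phi a ε₁ ε₂ V₁ f))) := by
  refine ⟨fun V hV => Phi_eq_vhat hV, fun V W hV hW => ⟨(isEvol_bracket ha hε₁ hε₂ hV hW).1,
    fun f => ?_⟩, fun V hV => eq_zero_of_vhat_eq_zero ha hε₁ hε₂ hV, fun V W hV hW => ?_⟩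
  · rw [Phi_bracket ha hε₁ hε₂ hV hW, Derivation.commutator_apply]
  have hevol := (isEvol_bracket ha hε₁ hε₂ hV hW).1
  have hPhi := Phi_bracket ha hε₁ hε₂ hV hW
  constructor
  · intro h f
    rw [h, Phi, vhat_zero_k.1, vhat_zero_k.2] at hPhi
    have h0 : evolDer2 (0, 0) = 0 := derivation_ext_of_Dx_comm (Dx_evolDer2 _) (by simp)
      (evolDer2_k1 _) (evolDer2_k2 _)
    rw [← sub_eq_zero, ← Derivation.commutator_apply, ← hPhi, h0, Derivation.zero_apply]
  · intro h
    have h0 : ∀ f, vhat a ε₁ ε₂ 0 (bracket a ε₁ ε₂ 0 V W) f = 0 := fun f => by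
      rw [← Phi_eq_vhat hevol, hPhi, Derivation.commutator_apply, h f, sub_self]
    exact eq_zero_of_vhat_eq_zero ha hε₁ hε₂ hevol (h0 k1) (h0 k2)
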